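/- Theorem (Poisson property): On the supercommutative algebra A = ℂ[z¹, z², λ₁, λ₂] ⊗ Λ(ξ₁, ξ₂, ξ₃, ξ₄), the bracket determined by the superbivector π = λ₁λ₂ ∂/∂z¹ ∧ ∂/∂z² + ½(λ₁² + λ₂²) Σᵢ₌₁⁴ ∂/∂ξᵢ ∨ ∂/∂ξᵢ, namely {f, g} = λ₁λ₂(∂_{z¹}f ∂_{z²}g − ∂_{z²}f ∂_{z¹}g) + (λ₁² + λ₂²) Σᵢ₌₁⁴ (−1)^{|f|} (∂_{ξᵢ}f)(∂_{ξᵢ}g) for homogeneous f, g, is an even super Poisson bracket: it is even ( |{f,g}| = |f| + |g| ), super antisymmetric ({f,g} = −(−1)^{|f||g|}{g,f}), satisfies the super Leibniz rule ({f, g·h} = {f,g}·h + (−1)^{|f||g|} g·{f,h}), and satisfies the super Jacobi identity ((−1)^{|f||h|}{f,{g,h}} + (−1)^{|g||f|}{g,{h,f}} + (−1)^{|h||g|}{h,{f,g}} = 0). -/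

import Mathlib

/-!
The superbivector `π = λ₁λ₂ ∂_{z¹} ∧ ∂_{z²} + ½(λ₁² + λ₂²) Σᵢ ∂_{ξᵢ} ∨ ∂_{ξᵢ}` on
`A = ℂ[z¹, z², λ₁, λ₂] ⊗ Λ(ξ₁, ξ₂, ξ₃, ξ₄)` determines an even super Poisson bracket.
-/

open scoped TensorProduct

noncomputable section

/-- The supercommutative algebra `A = ℂ[z¹, z², λ₁, λ₂] ⊗ Λ(ξ₁, ξ₂, ξ₃, ξ₄)`. -/
abbrev TwAlg := MvPolynomial (Fin 2 ⊕ Fin 2) ℂ ⊗[ℂ] ExteriorAlgebra ℂ (Fin 4 → ℂ)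

/-- The even generator `z^α`. -/
def z (α : Fin 2) : TwAlg := MvPolynomial.X (Sum.inl α) ⊗ₜ 1

/-- The even generator `λ_α̇`. -/
def lam (α : Fin 2) : TwAlg := MvPolynomial.X (Sum.inr α) ⊗ₜ 1

/-- The odd generator `ξᵢ`. -/
def xi (i : Fin 4) : TwAlg := 1 ⊗ₜ ExteriorAlgebra.ι ℂ (Pi.single i 1)

/-- The even derivation `∂/∂z^α`. -/
def Dz (α : Fin 2) : TwAlg →ₗ[ℂ] TwAlg :=
  TensorProduct.map (MvPolynomial.pderiv (Sum.inl α)).toLinearMap LinearMap.id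

/-- The (left) odd derivation `∂/∂ξᵢ` (contraction with the dual basis). -/
def Dxi (i : Fin 4) : TwAlg →ₗ[ℂ] TwAlg :=
  TensorProduct.map LinearMap.id (CliffordAlgebra.contractLeft (LinearMap.proj i))

/-- The grade involution of `A` (identity on even variables, `ξ ↦ -ξ`). -/
def alphaA : TwAlg →ₗ[ℂ] TwAlg :=
  TensorProduct.map LinearMap.id (CliffordAlgebra.involute (Q := 0)).toLinearMap

/-- `f` is homogeneous of Grassmann parity `p`. -/
def IsHomog (p : ZMod 2) (f : TwAlg) : Prop :=
  alphaA f = if p = 0 then f else -f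

/-- The sign `(-1)^p` for `p : ZMod 2`. -/
def sgn (p : ZMod 2) : ℂ := if p = 0 then 1 else -1

/-- `λ₁λ₂`. -/
def lamlam : TwAlg := lam 0 * lam 1

/-- `λ₁² + λ₂²`. -/
def lamSq : TwAlg := lam 0 * lam 0 + lam 1 * lam 1

/-- The bracket determined by the superbivector
`π = λ₁λ₂ ∂_{z¹} ∧ ∂_{z²} + ½(λ₁² + λ₂²) Σᵢ₌₁⁴ ∂_{ξᵢ} ∨ ∂_{ξᵢ}` on elements `f` of
parity `p`:
`{f, g} = λ₁λ₂(∂_{z¹}f ∂_{z²}g − ∂_{z²}f ∂_{z¹}g) + (λ₁² + λ₂²) Σᵢ (−1)^p (∂_{ξᵢ}f)(∂_{ξᵢ}g)`. -/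
def br (p : ZMod 2) (f g : TwAlg) : TwAlg :=
  lamlam * (Dz 0 f * Dz 1 g - Dz 1 f * Dz 0 g) +
    sgn p • (lamSq * ∑ i : Fin 4, Dxi i f * Dxi i g)

namespace ExteriorAlgebra

open CliffordAlgebra

variable {R M : Type*} [CommRing R] [AddCommGroup M] [Module R M]

theorem contractLeft_mul (d : Module.Dual R M) (x y : ExteriorAlgebra R M) :
    contractLeft d (x * y) = contractLeft d x * y + involute x * contractLeft d y := by
  induction x using CliffordAlgebra.left_induction with
  | algebraMap r => simp [contractLeft_algebraMap_mul]
  | add a b ha hb => simp only [add_mul, map_add, ha, hb]; abel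
  | ι_mul a m ha =>
    simp only [mul_assoc, contractLeft_ι_mul, ha, map_mul, involute_ι, mul_add, sub_mul,
      smul_mul_assoc, neg_mul]
    abel

theorem involute_contractLeft (d : Module.Dual R M) (x : ExteriorAlgebra R M) :
    involute (contractLeft d x) = -contractLeft d (involute x) := by
  induction x using CliffordAlgebra.left_induction with
  | algebraMap r => simp
  | add a b ha hb => simp only [map_add, ha, hb]; abel
  | ι_mul a m ha =>
    rw [contractLeft_ι_mul, map_sub, map_smul, map_mul, map_mul, ha, involute_ι, neg_mul, neg_mul,
      map_neg, contractLeft_ι_mul, mul_neg]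
    abel

theorem ι_mul_eq_involute_mul_ι (m : M) (y : ExteriorAlgebra R M) :
    ι R m * y = involute y * ι R m := by
  induction y using CliffordAlgebra.left_induction with
  | algebraMap r => simp [Algebra.commutes]
  | add a b ha hb => simp only [mul_add, add_mul, map_add, ha, hb]
  | ι_mul a n ha =>
    have h : ι R m * ι R n = -(ι R n * ι R m) := eq_neg_of_add_eq_zero_left (ι_add_mul_swap m n)
    change ι R m * (ι R n * a) = involute (ι R n * a) * ι R m
    have hι : involute (ι R n) = -ι R n := involute_ι n
    rw [← mul_assoc, h, neg_mul, mul_assoc, ha, map_mul, ← mul_assoc, hι, neg_mul, neg_mul]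

/-- Supercommutativity of the exterior algebra, without homogeneity hypotheses. -/
theorem two_mul_mul_eq (x y : ExteriorAlgebra R M) :
    2 * (x * y) = (y + involute y) * x + (y - involute y) * involute x := by
  induction x using CliffordAlgebra.left_induction generalizing y with
  | algebraMap r =>
    have hr : involute (algebraMap R (CliffordAlgebra (0 : QuadraticForm R M)) r) =
        algebraMap R _ r := AlgHom.commutes _ _
    rw [hr, ← add_mul, Algebra.commutes, add_add_sub_cancel, ← two_mul, mul_assoc]
  | add a b ha hb =>
    simp only [mul_add, add_mul, map_add, ha, hb]
    abel
  | ι_mul a m ha =>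
    change 2 * (ι R m * a * y) = (y + involute y) * (ι R m * a)
      + (y - involute y) * involute (ι R m * a)
    have h2 : (2 : ExteriorAlgebra R M) * (ι R m * a * y) = ι R m * (2 * (a * y)) := by
      simp only [two_mul, mul_add, mul_assoc]
    have hι : involute (ι R m) = -ι R m := involute_ι m
    rw [h2, ha, mul_add, ← mul_assoc, ← mul_assoc, ι_mul_eq_involute_mul_ι,
      ι_mul_eq_involute_mul_ι, map_mul, hι, map_add, map_sub, involute_involute]
    simp only [add_mul, sub_mul, neg_mul, mul_neg, mul_assoc]
    abel

/-- Supercommutativity of the exterior algebra, in subtraction-free form. -/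
theorem two_mul_mul_add (x y : ExteriorAlgebra R M) :
    2 * (x * y) + involute y * involute x = (y + involute y) * x + y * involute x := by
  rw [two_mul_mul_eq, sub_mul]
  abel

end ExteriorAlgebra

theorem sgn_zero : sgn 0 = 1 := if_pos rfl

theorem sgn_one : sgn 1 = -1 := if_neg one_ne_zero

theorem eq_zero_or_eq_one (p : ZMod 2) : p = 0 ∨ p = 1 := by
  revert p; decide

theorem neg_sgn (p : ZMod 2) : -sgn p = sgn (p + 1) := by
  have h : (1 + 1 : ZMod 2) = 0 := by decide
  rcases eq_zero_or_eq_one p with rfl | rfl <;> simp [h, sgn_zero, sgn_one]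

theorem sgn_add (p q : ZMod 2) : sgn (p + q) = sgn p * sgn q := by
  rcases eq_zero_or_eq_one q with rfl | rfl <;> simp [← neg_sgn, sgn_zero, sgn_one]

/-- A superbivector `∑ₐ kₐ Dₐ ⊗ Dₐ'` with constant coefficients `kₐ` on a supercommutative algebra,
where the `Dₐ` are supercommuting superderivations and `a ↦ a'` is a parity preserving involution
of the index set. -/
structure ConstSuperBivector (A ι : Type*) [Ring A] [Algebra ℂ A] where
  /-- The grade involution. -/
  grade : A →ₐ[ℂ] A
  two_mul_mul_add (f g : A) :
    2 * (f * g) + grade g * grade f = (g + grade g) * f + g * grade f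
  /-- The parity of an index. -/
  parity : ι → ZMod 2
  /-- The involution of the index set. -/
  conj : ι ≃ ι
  conj_conj (a : ι) : conj (conj a) = a
  parity_conj (a : ι) : parity (conj a) = parity a
  /-- The superderivations. -/
  D : ι → A →ₗ[ℂ] A
  grade_D (a : ι) (f : A) : grade (D a f) = sgn (parity a) • D a (grade f)
  D_mul_of_even (a : ι) (ha : parity a = 0) (f g : A) : D a (f * g) = D a f * g + f * D a g
  D_mul_of_odd (a : ι) (ha : parity a = 1) (f g : A) : D a (f * g) = D a f * g + grade f * D a g
  D_D (a b : ι) (f : A) : D a (D b f) = sgn (parity a * parity b) • D b (D a f)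
  /-- The coefficients. -/
  coeff : ι → A
  grade_coeff (a : ι) : grade (coeff a) = coeff a
  D_coeff (a b : ι) : D a (coeff b) = 0
  coeff_conj (a : ι) : coeff (conj a) = (-sgn (parity a)) • coeff a

namespace ConstSuperBivector

variable {A ι : Type*} [Ring A] [Algebra ℂ A] (B : ConstSuperBivector A ι)

/-- Elements of Grassmann parity `p`. -/
def Homog (p : ZMod 2) (f : A) : Prop := B.grade f = sgn p • f

variable {B} {p q r : ZMod 2} {f g h : A}

theorem Homog.sum {κ : Type*} {s : Finset κ} {F : κ → A} (hF : ∀ i ∈ s, B.Homog p (F i)) :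
    B.Homog p (∑ i ∈ s, F i) := by
  rw [Homog, map_sum, Finset.smul_sum]
  exact Finset.sum_congr rfl hF

theorem Homog.smul (c : ℂ) (hf : B.Homog p f) : B.Homog p (c • f) := by
  rw [Homog, map_smul, hf, smul_comm]

theorem Homog.mul (hf : B.Homog p f) (hg : B.Homog q g) : B.Homog (p + q) (f * g) := by
  rw [Homog, map_mul, hf, hg, smul_mul_smul_comm, sgn_add]

variable (B) in
theorem two_mul_mul (f g : A) :
    2 * (f * g) = (g + B.grade g) * f + (g - B.grade g) * B.grade f := by
  rw [sub_mul, add_sub, ← B.two_mul_mul_add, add_sub_cancel_right]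

theorem Homog.mul_comm (hf : B.Homog p f) (hg : B.Homog q g) :
    f * g = sgn (p * q) • (g * f) := by
  have key : (2 : ℂ) • (f * g) = (2 : ℂ) • (sgn (p * q) • (g * f)) := by
    rw [two_smul, ← two_mul, B.two_mul_mul f g, hf, hg]
    rcases eq_zero_or_eq_one p with rfl | rfl <;> rcases eq_zero_or_eq_one q with rfl | rfl <;>
      simp [sgn_zero, sgn_one, two_smul, add_mul]
  have : IsUnit (2 : ℂ) := by simp
  exact this.smul_left_cancel.1 key

theorem Homog.D (hf : B.Homog p f) (a : ι) : B.Homog (p + B.parity a) (B.D a f) := by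
  rw [Homog, B.grade_D, hf, map_smul, smul_smul, sgn_add, _root_.mul_comm]

theorem Homog.D_mul (hf : B.Homog p f) (a : ι) (g : A) :
    B.D a (f * g) = B.D a f * g + sgn (p * B.parity a) • (f * B.D a g) := by
  rcases eq_zero_or_eq_one (B.parity a) with ha | ha
  · rw [B.D_mul_of_even a ha, ha, mul_zero, sgn_zero, one_smul]
  · rw [B.D_mul_of_odd a ha, ha, mul_one, hf, smul_mul_assoc]

variable (B)

theorem homog_coeff (a : ι) : B.Homog 0 (B.coeff a) := by
  rw [Homog, B.grade_coeff, sgn_zero, one_smul]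

theorem coeff_mul_comm (a : ι) (f : A) : B.coeff a * f = f * B.coeff a := by
  have h := B.two_mul_mul f (B.coeff a)
  rw [B.grade_coeff, sub_self, zero_mul, add_zero, ← two_mul, mul_assoc] at h
  have h' : (2 : ℂ) • (f * B.coeff a) = (2 : ℂ) • (B.coeff a * f) := by
    rw [two_smul, two_smul, ← two_mul, ← two_mul, h]
  have : IsUnit (2 : ℂ) := by simp
  exact (this.smul_left_cancel.1 h').symm

theorem D_coeff_mul (a b : ι) (f : A) : B.D a (B.coeff b * f) = B.coeff b * B.D a f := by
  rw [(B.homog_coeff b).D_mul, B.D_coeff, zero_mul, zero_add, zero_mul, sgn_zero, one_smul]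

variable [Fintype ι]

/-- The bracket determined by a superbivector, for `f` of parity `p`. -/
def bracket (p : ZMod 2) (f g : A) : A :=
  ∑ a, sgn (p * B.parity a) • (B.coeff a * (B.D a f * B.D (B.conj a) g))

variable {B}

theorem homog_bracket (hf : B.Homog p f) (hg : B.Homog q g) :
    B.Homog (p + q) (B.bracket p f g) := by
  refine Homog.sum fun a _ => Homog.smul _ ?_
  have h := (B.homog_coeff a).mul ((hf.D a).mul (hg.D (B.conj a)))
  rw [B.parity_conj] at h
  have e : ∀ p q c : ZMod 2, 0 + (p + c + (q + c)) = p + q := by decide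
  rwa [e] at h

theorem bracket_antisymm (hf : B.Homog p f) (hg : B.Homog q g) :
    B.bracket p f g = -(sgn (p * q)) • B.bracket q g f := by
  rw [bracket, bracket, ← Equiv.sum_comp B.conj, Finset.smul_sum]
  refine Finset.sum_congr rfl fun a _ => ?_
  rw [B.conj_conj, B.coeff_conj, B.parity_conj, (hf.D (B.conj a)).mul_comm (hg.D a), B.parity_conj]
  simp only [smul_mul_assoc, mul_smul_comm, smul_smul, neg_sgn, ← sgn_add]
  congr 2
  generalize B.parity a = c
  clear hf hg
  revert p q c
  decide

theorem bracket_mul (hf : B.Homog p f) (hg : B.Homog q g) (h : A) :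
    B.bracket p f (g * h) = B.bracket p f g * h + sgn (p * q) • (g * B.bracket p f h) := by
  simp only [bracket, Finset.sum_mul, Finset.mul_sum, Finset.smul_sum, ← Finset.sum_add_distrib]
  refine Finset.sum_congr rfl fun a _ => ?_
  have e : g * (B.coeff a * (B.D a f * B.D (B.conj a) h)) =
      sgn (q * (p + B.parity a)) • (B.coeff a * (B.D a f * (g * B.D (B.conj a) h))) := by
    rw [← mul_assoc, ← B.coeff_mul_comm, mul_assoc, ← mul_assoc g, hg.mul_comm (hf.D a)]
    simp only [smul_mul_assoc, mul_smul_comm, mul_assoc]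
  rw [hg.D_mul]
  simp only [mul_smul_comm, smul_mul_assoc, e, mul_add, smul_add, smul_smul, mul_assoc,
    B.parity_conj, ← sgn_add]
  congr 3
  generalize B.parity a = c
  clear hf hg e
  revert p q c
  decide

variable (B)

/-- The part of `{f, {g, h}}` in which `g` is differentiated twice. -/
def bracketBracketMid (p q : ZMod 2) (f g h : A) : A :=
  ∑ a, ∑ b, sgn (p * B.parity a + q * B.parity b) • (B.coeff a * (B.coeff b *
    (B.D a f * (B.D (B.conj a) (B.D b g) * B.D (B.conj b) h))))

/-- The part of `{f, {g, h}}` in which `h` is differentiated twice. -/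
def bracketBracketLast (p q : ZMod 2) (f g h : A) : A :=
  ∑ a, ∑ b, sgn (p * B.parity a + q * B.parity b + (q + B.parity b) * B.parity a) •
    (B.coeff a * (B.coeff b * (B.D a f * (B.D b g * B.D (B.conj a) (B.D (B.conj b) h)))))

variable {B}

theorem bracket_bracket (p : ZMod 2) (f : A) (hg : B.Homog q g) (h : A) :
    B.bracket p f (B.bracket q g h) =
      B.bracketBracketMid p q f g h + B.bracketBracketLast p q f g h := by
  rw [bracket, bracket, bracketBracketMid, bracketBracketLast, ← Finset.sum_add_distrib]
  refine Finset.sum_congr rfl fun a _ => ?_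
  simp only [map_sum, Finset.mul_sum, Finset.smul_sum, ← Finset.sum_add_distrib]
  refine Finset.sum_congr rfl fun b _ => ?_
  rw [map_smul, D_coeff_mul, (hg.D b).D_mul, B.parity_conj, mul_smul_comm, mul_smul_comm,
    ← mul_assoc (B.D a f), ← coeff_mul_comm, mul_assoc]
  simp only [mul_add, smul_add, mul_smul_comm, smul_smul, sgn_add, mul_assoc]

theorem bracketBracketMid_add_bracketBracketLast (hf : B.Homog p f) (hg : B.Homog q g)
    (hh : B.Homog r h) :
    sgn (p * r) • B.bracketBracketMid p q f g h +
      sgn (r * q) • B.bracketBracketLast r p h f g = 0 := by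
  have hlast : B.bracketBracketLast r p h f g = ∑ a, ∑ b,
      sgn (r * B.parity b + p * B.parity a + (p + B.parity a) * B.parity b) •
        (B.coeff (B.conj b) * (B.coeff a * (B.D (B.conj b) h *
          (B.D a f * B.D b (B.D (B.conj a) g))))) := by
    rw [bracketBracketLast, ← Equiv.sum_comp B.conj, Finset.sum_comm]
    simp only [B.parity_conj, B.conj_conj]
  rw [hlast, bracketBracketMid]
  simp only [Finset.smul_sum, ← Finset.sum_add_distrib]
  refine Finset.sum_eq_zero fun a _ => Finset.sum_eq_zero fun b _ => ?_
  have hrot := (hh.D (B.conj b)).mul_comm ((hf.D a).mul ((hg.D b).D (B.conj a)))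
  rw [B.D_D b, B.parity_conj, B.coeff_conj]
  simp only [mul_smul_comm, smul_mul_assoc, smul_smul]
  rw [hrot, ← mul_assoc (B.coeff b) (B.coeff a), B.coeff_mul_comm b (B.coeff a)]
  simp only [mul_smul_comm, smul_smul, mul_assoc, B.parity_conj, neg_sgn, ← sgn_add]
  rw [← add_smul]
  convert zero_smul ℂ _
  rw [add_eq_zero_iff_eq_neg, neg_sgn]
  congr 1
  generalize B.parity a = c
  generalize B.parity b = d
  clear hf hg hh hrot hlast
  revert p q r c d
  decide

theorem bracket_jacobi (hf : B.Homog p f) (hg : B.Homog q g) (hh : B.Homog r h) :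
    sgn (p * r) • B.bracket p f (B.bracket q g h) + sgn (q * p) • B.bracket q g (B.bracket r h f) +
      sgn (r * q) • B.bracket r h (B.bracket p f g) = 0 := by
  rw [bracket_bracket p f hg, bracket_bracket q g hh, bracket_bracket r h hf]
  have h1 := bracketBracketMid_add_bracketBracketLast hf hg hh
  have h2 := bracketBracketMid_add_bracketBracketLast hg hh hf
  have h3 := bracketBracketMid_add_bracketBracketLast hh hf hg
  have e := congrArg₂ (· + ·) (congrArg₂ (· + ·) h1 h2) h3
  simp only [add_zero] at e
  rw [← e]
  simp only [smul_add]
  abel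

end ConstSuperBivector

theorem MvPolynomial.pderiv_pderiv_comm {R σ : Type*} [CommRing R] (i j : σ)
    (f : MvPolynomial σ R) : pderiv i (pderiv j f) = pderiv j (pderiv i f) := by
  classical
  have h : ⁅pderiv (R := R) i, pderiv (R := R) j⁆ = 0 := by
    refine MvPolynomial.derivation_ext fun k => ?_
    simp only [Derivation.commutator_apply, pderiv_X, Pi.single_apply]
    split_ifs <;> simp
  have h' := congrArg (fun D => D f) h
  simpa [Derivation.commutator_apply, sub_eq_zero] using h'

namespace TwAlg

/-- The grade involution as an algebra homomorphism. -/
def grade : TwAlg →ₐ[ℂ] TwAlg :=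
  Algebra.TensorProduct.map (AlgHom.id ℂ _) CliffordAlgebra.involute

theorem grade_tmul (a : MvPolynomial (Fin 2 ⊕ Fin 2) ℂ) (x : ExteriorAlgebra ℂ (Fin 4 → ℂ)) :
    grade (a ⊗ₜ x) = a ⊗ₜ CliffordAlgebra.involute x := rfl

theorem Dz_tmul (α : Fin 2) (a : MvPolynomial (Fin 2 ⊕ Fin 2) ℂ)
    (x : ExteriorAlgebra ℂ (Fin 4 → ℂ)) :
    Dz α (a ⊗ₜ x) = MvPolynomial.pderiv (Sum.inl α) a ⊗ₜ x := rfl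

theorem Dxi_tmul (i : Fin 4) (a : MvPolynomial (Fin 2 ⊕ Fin 2) ℂ)
    (x : ExteriorAlgebra ℂ (Fin 4 → ℂ)) :
    Dxi i (a ⊗ₜ x) = a ⊗ₜ CliffordAlgebra.contractLeft (LinearMap.proj i) x := rfl

theorem Dz_mul (α : Fin 2) (f g : TwAlg) : Dz α (f * g) = Dz α f * g + f * Dz α g := by
  induction f using TensorProduct.induction_on with
  | zero => simp
  | add a b ha hb => simp only [add_mul, map_add, ha, hb]; abel
  | tmul a x =>
    induction g using TensorProduct.induction_on with
    | zero => simp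
    | add c d hc hd => simp only [mul_add, map_add, hc, hd]; abel
    | tmul c y =>
      simp only [Algebra.TensorProduct.tmul_mul_tmul, Dz_tmul, MvPolynomial.pderiv_mul,
        TensorProduct.add_tmul]

theorem Dxi_mul (i : Fin 4) (f g : TwAlg) :
    Dxi i (f * g) = Dxi i f * g + grade f * Dxi i g := by
  induction f using TensorProduct.induction_on with
  | zero => simp
  | add a b ha hb => simp only [add_mul, map_add, ha, hb]; abel
  | tmul a x =>
    induction g using TensorProduct.induction_on with
    | zero => simp
    | add c d hc hd => simp only [mul_add, map_add, hc, hd]; abel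
    | tmul c y =>
      simp only [Algebra.TensorProduct.tmul_mul_tmul, Dxi_tmul, grade_tmul,
        ExteriorAlgebra.contractLeft_mul, TensorProduct.tmul_add]

theorem two_mul_mul_add (f g : TwAlg) :
    2 * (f * g) + grade g * grade f = (g + grade g) * f + g * grade f := by
  simp only [two_mul, add_mul]
  induction f using TensorProduct.induction_on with
  | zero => simp
  | add a b ha hb =>
    have h := congrArg₂ (· + ·) ha hb
    simp only [mul_add, add_mul, map_add] at h ⊢
    convert h using 1 <;> abel
  | tmul a x =>
    induction g using TensorProduct.induction_on with
    | zero => simp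
    | add c d hc hd =>
      have h := congrArg₂ (· + ·) hc hd
      simp only [mul_add, add_mul, map_add] at h ⊢
      convert h using 1 <;> abel
    | tmul c y =>
      have h := congrArg (fun w => (c * a) ⊗ₜ[ℂ] w) (ExteriorAlgebra.two_mul_mul_add x y)
      simp only [two_mul, TensorProduct.tmul_add, add_mul] at h
      simp only [Algebra.TensorProduct.tmul_mul_tmul, grade_tmul]
      rw [mul_comm a c]
      exact h

theorem grade_Dz (α : Fin 2) (f : TwAlg) : grade (Dz α f) = Dz α (grade f) := by
  induction f using TensorProduct.induction_on with
  | zero => simp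
  | add a b ha hb => simp only [map_add, ha, hb]
  | tmul a x => rfl

theorem grade_Dxi (i : Fin 4) (f : TwAlg) : grade (Dxi i f) = (-1 : ℂ) • Dxi i (grade f) := by
  induction f using TensorProduct.induction_on with
  | zero => simp
  | add a b ha hb => simp only [map_add, ha, hb, smul_add]
  | tmul a x =>
    rw [Dxi_tmul, grade_tmul, grade_tmul, Dxi_tmul, ExteriorAlgebra.involute_contractLeft,
      ← TensorProduct.tmul_smul, neg_one_smul]

theorem Dz_Dz (α β : Fin 2) (f : TwAlg) : Dz α (Dz β f) = Dz β (Dz α f) := by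
  induction f using TensorProduct.induction_on with
  | zero => simp
  | add a b ha hb => simp only [map_add, ha, hb]
  | tmul a x => simp only [Dz_tmul, MvPolynomial.pderiv_pderiv_comm (Sum.inl α)]

theorem Dz_Dxi (α : Fin 2) (i : Fin 4) (f : TwAlg) : Dz α (Dxi i f) = Dxi i (Dz α f) := by
  induction f using TensorProduct.induction_on with
  | zero => simp
  | add a b ha hb => simp only [map_add, ha, hb]
  | tmul a x => rfl

theorem Dxi_Dxi (i j : Fin 4) (f : TwAlg) : Dxi i (Dxi j f) = (-1 : ℂ) • Dxi j (Dxi i f) := by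
  induction f using TensorProduct.induction_on with
  | zero => simp
  | add a b ha hb => simp only [map_add, ha, hb, smul_add]
  | tmul a x =>
    rw [Dxi_tmul, Dxi_tmul, Dxi_tmul, Dxi_tmul, CliffordAlgebra.contractLeft_comm,
      ← TensorProduct.tmul_smul, neg_one_smul]

theorem Dz_lam (α β : Fin 2) : Dz α (lam β) = 0 := by
  rw [lam, Dz_tmul, MvPolynomial.pderiv_X_of_ne Sum.inr_ne_inl, TensorProduct.zero_tmul]

theorem grade_lam (β : Fin 2) : grade (lam β) = lam β := by
  rw [lam, grade_tmul, map_one]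

theorem Dxi_lam (i : Fin 4) (β : Fin 2) : Dxi i (lam β) = 0 := by
  have h : CliffordAlgebra.contractLeft (Q := (0 : QuadraticForm ℂ (Fin 4 → ℂ)))
    (LinearMap.proj i) 1 = 0 := CliffordAlgebra.contractLeft_one _ _
  rw [lam, Dxi_tmul]
  exact (congrArg (MvPolynomial.X (Sum.inr β) ⊗ₜ[ℂ] ·) h).trans (TensorProduct.tmul_zero _ _)

/-- The coefficients of the superbivector `π`. -/
def coeff : Fin 2 ⊕ Fin 4 → TwAlg
  | .inl α => (if α = 0 then (1 : ℂ) else -1) • lamlam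
  | .inr _ => lamSq

theorem grade_coeff (a : Fin 2 ⊕ Fin 4) : grade (coeff a) = coeff a := by
  rcases a with a | a <;>
    simp only [coeff, map_smul, lamlam, lamSq, map_add, map_mul, grade_lam]

theorem Dz_coeff (α : Fin 2) (a : Fin 2 ⊕ Fin 4) : Dz α (coeff a) = 0 := by
  rcases a with a | a <;>
    simp only [coeff, map_smul, lamlam, lamSq, map_add, Dz_mul, Dz_lam, zero_mul, mul_zero,
      add_zero, smul_zero]

theorem Dxi_coeff (i : Fin 4) (a : Fin 2 ⊕ Fin 4) : Dxi i (coeff a) = 0 := by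
  rcases a with a | a <;>
    simp only [coeff, map_smul, lamlam, lamSq, map_add, Dxi_mul, Dxi_lam, zero_mul, mul_zero,
      add_zero, smul_zero]

/-- The superbivector `π`. -/
def superBivector : ConstSuperBivector TwAlg (Fin 2 ⊕ Fin 4) where
  grade := grade
  two_mul_mul_add := two_mul_mul_add
  parity := Sum.elim (fun _ => 0) (fun _ => 1)
  conj := Equiv.sumCongr (Equiv.swap 0 1) (Equiv.refl _)
  conj_conj a := by rcases a with a | a <;> simp
  parity_conj a := by rcases a with a | a <;> rfl
  D := Sum.elim Dz Dxi
  grade_D a f := by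
    rcases a with a | a
    · simp only [Sum.elim_inl, sgn_zero, one_smul, grade_Dz]
    · simp only [Sum.elim_inr, sgn_one, grade_Dxi]
  D_mul_of_even a ha f g := by
    rcases a with a | a
    · exact Dz_mul a f g
    · exact absurd ha one_ne_zero
  D_mul_of_odd a ha f g := by
    rcases a with a | a
    · exact absurd ha zero_ne_one
    · exact Dxi_mul a f g
  D_D a b f := by
    rcases a with a | a <;> rcases b with b | b <;>
      simp only [Sum.elim_inl, Sum.elim_inr, mul_zero, mul_one, sgn_zero, sgn_one,
        one_smul]
    · exact Dz_Dz a b f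
    · exact Dz_Dxi a b f
    · exact (Dz_Dxi b a f).symm
    · exact Dxi_Dxi a b f
  coeff := coeff
  grade_coeff := grade_coeff
  D_coeff a b := by
    rcases a with a | a
    · exact Dz_coeff a b
    · exact Dxi_coeff a b
  coeff_conj a := by
    rcases a with a | a
    · fin_cases a <;> simp [coeff, smul_smul, sgn_zero]
    · rw [Sum.elim_inr, sgn_one, neg_neg, one_smul]
      rfl

theorem homog_iff {p : ZMod 2} {f : TwAlg} : superBivector.Homog p f ↔ IsHomog p f := by
  change alphaA f = sgn p • f ↔ alphaA f = _
  rcases eq_zero_or_eq_one p with rfl | rfl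
  · rw [sgn_zero, one_smul, if_pos rfl]
  · have h : (-1 : ℂ) • f = -f := neg_one_smul ℂ f
    rw [sgn_one, if_neg one_ne_zero, h]

theorem bracket_eq_br (p : ZMod 2) (f g : TwAlg) : superBivector.bracket p f g = br p f g := by
  rw [ConstSuperBivector.bracket, Fintype.sum_sum_type, Fin.sum_univ_two, br]
  have h (x y z : TwAlg) : x * (y - z) = x * y + (-1 : ℂ) • (x * z) := by
    have h' : (-1 : ℂ) • (x * z) = -(x * z) := neg_one_smul ℂ (x * z)
    rw [h', ← sub_eq_add_neg]
    exact mul_sub x y z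
  rw [h, Finset.mul_sum, Finset.smul_sum]
  have h₀ : sgn (p * 0) = 1 := by rw [mul_zero, sgn_zero]
  congr 1
  · congr 1
    · change sgn (p * 0) • ((1 : ℂ) • lamlam * (Dz 0 f * Dz 1 g)) = _
      rw [h₀, one_smul, one_smul]
    · change sgn (p * 0) • ((-1 : ℂ) • lamlam * (Dz 1 f * Dz 0 g)) = _
      rw [h₀, one_smul, smul_mul_assoc]
  · refine Finset.sum_congr rfl fun i _ => ?_
    change sgn (p * 1) • _ = _
    rw [mul_one]
    rfl

end TwAlg

/-- The bracket determined by the superbivector `π` is an even super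
Poisson bracket: it is even, super antisymmetric, satisfies the super Leibniz rule and
the super Jacobi identity. -/
theorem br_superPoisson :
    (∀ (p q : ZMod 2) (f g : TwAlg), IsHomog p f → IsHomog q g →
      IsHomog (p + q) (br p f g)) ∧
    (∀ (p q : ZMod 2) (f g : TwAlg), IsHomog p f → IsHomog q g →
      br p f g = -(sgn (p * q)) • br q g f) ∧
    (∀ (p q : ZMod 2) (f g h : TwAlg), IsHomog p f → IsHomog q g →
      br p f (g * h) = br p f g * h + sgn (p * q) • (g * br p f h)) ∧
    (∀ (p q r : ZMod 2) (f g h : TwAlg), IsHomog p f → IsHomog q g → IsHomog r h →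
      sgn (p * r) • br p f (br q g h) + sgn (q * p) • br q g (br r h f) +
        sgn (r * q) • br r h (br p f g) = 0) := by
  simp only [← TwAlg.homog_iff, ← TwAlg.bracket_eq_br]
  exact ⟨fun _ _ _ _ => ConstSuperBivector.homog_bracket,
    fun _ _ _ _ => ConstSuperBivector.bracket_antisymm,
    fun _ _ _ _ h hf hg => ConstSuperBivector.bracket_mul hf hg h,
    fun _ _ _ _ _ _ => ConstSuperBivector.bracket_jacobi⟩


end
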